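/- For all integers m ≥ 1, d ≥ 1, n ≥ 0 and all 0 ≤ s, t ≤ d, the mirror map ρ, which sends M = P_1 P_2 ⋯ P_n with P_i = D^{a_i} L^{b_i} U^{c_i} to ρ(M) = P̄_n P̄_{n−1} ⋯ P̄_1 with P̄_i = D^{c_i} L^{b_i} U^{a_i}, is a bijection from the set of m-regular Λ-avoiding DLU paths of length dn from (0,s) to (dn,t) onto the set of m-regular Λ-avoiding DLU paths of length dn from (0,t) to (dn,s), and ρ(ρ(M)) = M. -/

import Mathlib

/-- A step of a lattice path: up `(1,1)`, down `(1,-1)`, or horizontal `(1,0)`. -/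
inductive DStep : Type
  | U : DStep
  | D : DStep
  | L : DStep
  deriving DecidableEq

/-- The vertical displacement of a step. -/
def DStep.val : DStep → ℤ
  | .U => 1
  | .D => -1
  | .L => 0

/-- Total vertical displacement of a word of steps. -/
def stepSum (w : List DStep) : ℤ := (w.map DStep.val).sum

/-- A word of the form `D^a L^b U^c` with `a + b + c = d`. -/
def IsPieceWord (d : ℕ) (p : List DStep) : Prop :=
  ∃ a b c : ℕ, a + b + c = d ∧
    p = List.replicate a DStep.D ++ List.replicate b DStep.L ++ List.replicate c DStep.U

/-- `M` is a DLU path of length `d*n` from `(0,s)` to `(d*n,t)`: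
each consecutive block (piece) of `d` steps has the form `D^a L^b U^c`,
the path starts at height `s`, ends at height `t`, and never passes below the x-axis. -/
def IsDLUPath (d n s t : ℕ) (M : List DStep) : Prop :=
  M.length = d * n ∧
  (∀ i < n, IsPieceWord d ((M.drop (d * i)).take d)) ∧
  (s : ℤ) + stepSum M = (t : ℤ) ∧
  ∀ k ≤ M.length, 0 ≤ (s : ℤ) + stepSum (M.take k)

/-- The completed path `M̂ = L^{d-s} U^s M D^t L^{d-t}`. -/
def hatPath (d s t : ℕ) (M : List DStep) : List DStep :=
  List.replicate (d - s) DStep.L ++ List.replicate s DStep.U ++ M ++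
    List.replicate t DStep.D ++ List.replicate (d - t) DStep.L

/-- `w` contains a contiguous subpath `U P D` with `P ∈ {∅, L^d, L^{2d}, …, L^{(m-2)d}}`. -/
def HasShortUD (m d : ℕ) (w : List DStep) : Prop :=
  ∃ k : ℕ, k + 2 ≤ m ∧
    ([DStep.U] ++ List.replicate (k * d) DStep.L ++ [DStep.D]) <:+: w

/-- `w` is `m`-regular: it contains no subpath `U P D` with
`P ∈ {∅, L^d, L^{2d}, …, L^{(m-2)d}}`. -/
def RegularWord (m d : ℕ) (w : List DStep) : Prop := ¬ HasShortUD m d w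

/-- `w` has pattern `Λ`: it contains a contiguous subpath `U U P D D` in which the two `U`'s
lie in a common piece (block of `d` steps), the two `D`'s lie in a common piece, and `P`
starts and ends at the same height `h` and never passes below height `h`. -/
def HasLambda (d : ℕ) (w : List DStep) : Prop :=
  ∃ pre P suf : List DStep,
    w = pre ++ [DStep.U, DStep.U] ++ P ++ [DStep.D, DStep.D] ++ suf ∧
    (pre.length + 1) % d ≠ 0 ∧
    (pre.length + P.length + 3) % d ≠ 0 ∧
    stepSum P = 0 ∧
    (∀ k ≤ P.length, 0 ≤ stepSum (P.take k))

/-- An `m`-regular `Λ`-avoiding DLU path of length `d*n` from `(0,s)` to `(d*n,t)`: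
the regularity and `Λ`-avoidance conditions are imposed on the completed path `M̂`. -/
def IsGoodPath (m d n s t : ℕ) (M : List DStep) : Prop :=
  IsDLUPath d n s t M ∧ RegularWord m d (hatPath d s t M) ∧ ¬ HasLambda d (hatPath d s t M)

/-- A prime path: an `m`-regular `Λ`-avoiding DLU path which never touches the x-axis. -/
def IsPrimePath (m d n s t : ℕ) (M : List DStep) : Prop :=
  IsGoodPath m d n s t M ∧ ∀ k ≤ M.length, 0 < (s : ℤ) + stepSum (M.take k)

/-- `g^{⟨s,t⟩}_{m,d}(dn)`: the number of `m`-regular `Λ`-avoiding DLU paths of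
length `d*n` from `(0,s)` to `(d*n,t)`. -/
noncomputable def gCount (m d n s t : ℕ) : ℕ := {M : List DStep | IsGoodPath m d n s t M}.ncard

/-- `a^{⟨s,t⟩}_{m,d}(dn)`: the number of prime `m`-regular `Λ`-avoiding DLU paths of
length `d*n` from `(0,s)` to `(d*n,t)`. -/
noncomputable def aCount (m d n s t : ℕ) : ℕ := {M : List DStep | IsPrimePath m d n s t M}.ncard

/-- The generating function `G^{⟨s,t⟩}_{m,d}(x) = Σ_{n≥0} g^{⟨s,t⟩}_{m,d}(dn) x^{dn}`. -/
noncomputable def Gps (m d s t : ℕ) : PowerSeries ℤ :=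
  PowerSeries.mk fun N => if d ∣ N then (gCount m d (N / d) s t : ℤ) else 0

/-- The generating function `A^{⟨s,t⟩}_{m,d}(x) = Σ_{n≥0} a^{⟨s,t⟩}_{m,d}(dn) x^{dn}`. -/
noncomputable def Aps (m d s t : ℕ) : PowerSeries ℤ :=
  PowerSeries.mk fun N => if d ∣ N then (aCount m d (N / d) s t : ℤ) else 0

/-- `C_{m,d}(x) = (x^{d(m-1)} - 1)/(x^d - 1) = Σ_{k=0}^{m-2} x^{dk}`. -/
noncomputable def Cps (m d : ℕ) : PowerSeries ℤ :=
  ∑ k ∈ Finset.range (m - 1), (PowerSeries.X : PowerSeries ℤ) ^ (d * k)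

/-- `S` is a `d`-contact stack on `[n]`: a set of arcs `(i,j)` with `1 ≤ i < j ≤ n`,
noncrossing, in which every vertex lies in at most `d` arcs. -/
def IsContactStack (d n : ℕ) (S : Finset (ℕ × ℕ)) : Prop :=
  (∀ p ∈ S, 1 ≤ p.1 ∧ p.1 < p.2 ∧ p.2 ≤ n) ∧
  (∀ p ∈ S, ∀ q ∈ S, ¬ (p.1 < q.1 ∧ q.1 < p.2 ∧ p.2 < q.2)) ∧
  (∀ v : ℕ, (S.filter fun p => p.1 = v ∨ p.2 = v).card ≤ d)

/-- Every arc of `S` has length at least `m`. -/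
def ArcsRegular (m : ℕ) (S : Finset (ℕ × ℕ)) : Prop := ∀ p ∈ S, m ≤ p.2 - p.1

/-- `S` is an `m`-regular `d`-contact stack on `[n]`. -/
def IsStack (m d n : ℕ) (S : Finset (ℕ × ℕ)) : Prop :=
  IsContactStack d n S ∧ ArcsRegular m S

/-- The left degree of vertex `v`: the number of arcs ending at `v`. -/
def ldeg (S : Finset (ℕ × ℕ)) (v : ℕ) : ℕ := (S.filter fun p => p.2 = v).card

/-- The right degree of vertex `v`: the number of arcs starting at `v`. -/
def rdeg (S : Finset (ℕ × ℕ)) (v : ℕ) : ℕ := (S.filter fun p => p.1 = v).card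

/-- The map `η`, sending a stack `S` on `[n]` to the word `P_1 P_2 ⋯ P_n` where
`P_v = D^{ldeg v} L^{d - ldeg v - rdeg v} U^{rdeg v}`. -/
def eta (d n : ℕ) (S : Finset (ℕ × ℕ)) : List DStep :=
  (List.range n).flatMap fun i =>
    List.replicate (ldeg S (i + 1)) DStep.D ++
      List.replicate (d - ldeg S (i + 1) - rdeg S (i + 1)) DStep.L ++
      List.replicate (rdeg S (i + 1)) DStep.U

/-- `s_{m,d}(n)`: the number of `m`-regular `d`-contact stacks on `[n]`. -/
noncomputable def sCount (m d n : ℕ) : ℕ := {S : Finset (ℕ × ℕ) | IsStack m d n S}.ncard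

/-- The generating function `S_{m,d}(x) = Σ_{n≥0} s_{m,d}(n) xⁿ`. -/
noncomputable def Sps (m d : ℕ) : PowerSeries ℤ := PowerSeries.mk fun n => (sCount m d n : ℤ)

/-- Swap up-steps and down-steps. -/
def DStep.flip : DStep → DStep
  | .U => .D
  | .D => .U
  | .L => .L

/-- The mirror map `ρ`, sending `M = P_1 P_2 ⋯ P_n` with `P_i = D^{a_i} L^{b_i} U^{c_i}` to
`ρ(M) = P̄_n P̄_{n-1} ⋯ P̄_1` with `P̄_i = D^{c_i} L^{b_i} U^{a_i}`. -/
def rho (M : List DStep) : List DStep := M.reverse.map DStep.flip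

theorem DStep.flip_flip' (x : DStep) : x.flip.flip = x := by cases x <;> rfl

theorem DStep.val_flip' (x : DStep) : x.flip.val = - x.val := by cases x <;> rfl

theorem rho_rho' (M : List DStep) : rho (rho M) = M := by
  unfold rho
  rw [← List.map_reverse, List.reverse_reverse, List.map_map]
  have : DStep.flip ∘ DStep.flip = id := funext DStep.flip_flip'
  rw [this, List.map_id]

theorem rho_append' (A B : List DStep) : rho (A ++ B) = rho B ++ rho A := by
  simp [rho]

theorem rho_length' (A : List DStep) : (rho A).length = A.length := by
  simp [rho]

theorem rho_replicate' (k : ℕ) (x : DStep) :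
    rho (List.replicate k x) = List.replicate k x.flip := by
  simp [rho]

theorem stepSum_append' (A B : List DStep) : stepSum (A ++ B) = stepSum A + stepSum B := by
  simp [stepSum]

theorem stepSum_rho' (A : List DStep) : stepSum (rho A) = - stepSum A := by
  induction A with
  | nil => rfl
  | cons x A ih =>
    have h : x :: A = [x] ++ A := rfl
    rw [h, rho_append', stepSum_append', stepSum_append', ih]
    have : stepSum (rho [x]) = - stepSum [x] := by
      simp [rho, stepSum, DStep.val_flip']
    rw [this]; ring

theorem rho_take' (A : List DStep) (k : ℕ) :
    (rho A).take k = rho (A.drop (A.length - k)) := by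
  simp [rho, List.take_reverse, ← List.map_take]

theorem rho_drop' (A : List DStep) (k : ℕ) :
    (rho A).drop k = rho (A.take (A.length - k)) := by
  simp [rho, List.drop_reverse, ← List.map_drop]

theorem stepSum_rho_take' (A : List DStep) (k : ℕ) :
    stepSum ((rho A).take k) = stepSum (A.take (A.length - k)) - stepSum A := by
  rw [rho_take', stepSum_rho']
  have h := stepSum_append' (A.take (A.length - k)) (A.drop (A.length - k))
  rw [List.take_append_drop] at h
  rw [h]; ring

theorem isPieceWord_rho' {d : ℕ} {p : List DStep} (h : IsPieceWord d p) :
    IsPieceWord d (rho p) := by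
  obtain ⟨a, b, c, hd, rfl⟩ := h
  refine ⟨c, b, a, by omega, ?_⟩
  simp [rho_append', rho_replicate', DStep.flip]

theorem isDLUPath_rho' {d n s t : ℕ} {M : List DStep} (h : IsDLUPath d n s t M) :
    IsDLUPath d n t s (rho M) := by
  obtain ⟨hl, hp, hsum, hnn⟩ := h
  refine ⟨by rw [rho_length', hl], ?_, ?_, ?_⟩
  · intro i hi
    have hq := isPieceWord_rho' (hp (n - 1 - i) (by omega))
    have e : ((rho M).drop (d * i)).take d = rho ((M.drop (d * (n - 1 - i))).take d) := by
      obtain ⟨j, rfl⟩ : ∃ j, n = i + 1 + j := ⟨n - (i + 1), by omega⟩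
      have h1 : i + 1 + j - 1 - i = j := by omega
      have h2 : M.length - d * i = d * j + d := by
        rw [hl, Nat.mul_add, Nat.mul_add]; omega
      have h3 : (M.take (d * j + d)).length = d * j + d := by
        rw [List.length_take]; omega
      rw [rho_drop', rho_take', h1, h2, h3, Nat.add_sub_cancel, List.drop_take,
        Nat.add_sub_cancel_left]
    rw [e]; exact hq
  · rw [stepSum_rho']; omega
  · intro k hk
    rw [stepSum_rho_take']
    have := hnn (M.length - k) (by omega)
    omega

theorem rho_hatPath' (d s t : ℕ) (M : List DStep) :
    rho (hatPath d s t M) = hatPath d t s (rho M) := by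
  simp [hatPath, rho_append', rho_replicate', DStep.flip]

theorem hasShortUD_rho' {m d : ℕ} {w : List DStep} (h : HasShortUD m d w) :
    HasShortUD m d (rho w) := by
  obtain ⟨k, hk, A, B, rfl⟩ := h
  refine ⟨k, hk, rho B, rho A, ?_⟩
  have h1 : rho [DStep.U] = [DStep.D] := rfl
  have h2 : rho [DStep.D] = [DStep.U] := rfl
  simp only [rho_append', rho_replicate', DStep.flip, h1, h2, List.append_assoc]

theorem hasLambda_rho' {d : ℕ} {w : List DStep} (hw : d ∣ w.length) (h : HasLambda d w) :
    HasLambda d (rho w) := by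
  obtain ⟨pre, P, suf, rfl, h1, h2, h3, h4⟩ := h
  have hu : rho [DStep.U, DStep.U] = [DStep.D, DStep.D] := rfl
  have hdd : rho [DStep.D, DStep.D] = [DStep.U, DStep.U] := rfl
  simp only [List.length_append, List.length_cons, List.length_nil] at hw
  refine ⟨rho suf, rho P, rho pre, ?_, ?_, ?_, ?_, ?_⟩
  · simp only [rho_append', hu, hdd, List.append_assoc]
  · intro h
    apply h2
    rw [rho_length'] at h
    apply Nat.mod_eq_zero_of_dvd
    refine (Nat.dvd_add_left (Nat.dvd_of_mod_eq_zero h)).1 ?_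
    convert hw using 1; omega
  · intro h
    apply h1
    rw [rho_length', rho_length'] at h
    apply Nat.mod_eq_zero_of_dvd
    refine (Nat.dvd_add_left (Nat.dvd_of_mod_eq_zero h)).1 ?_
    convert hw using 1; omega
  · rw [stepSum_rho', h3]; rfl
  · intro k hk
    rw [stepSum_rho_take', h3]
    have := h4 (P.length - k) (by omega)
    omega

theorem isGoodPath_rho' {m d n s t : ℕ} (hs : s ≤ d) (ht : t ≤ d) {M : List DStep}
    (h : IsGoodPath m d n s t M) : IsGoodPath m d n t s (rho M) := by
  obtain ⟨h1, h2, h3⟩ := h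
  refine ⟨isDLUPath_rho' h1, ?_, ?_⟩
  · intro hh
    apply h2
    have := hasShortUD_rho' hh
    rwa [rho_hatPath', rho_rho'] at this
  · intro hh
    apply h3
    have hlen : d ∣ (hatPath d t s (rho M)).length := by
      refine ⟨n + 2, ?_⟩
      simp only [hatPath, List.length_append, List.length_replicate, rho_length', h1.1]
      rw [Nat.mul_add]; omega
    have := hasLambda_rho' hlen hh
    rwa [rho_hatPath', rho_rho'] at this

theorem stmt5 (m d n s t : ℕ) (hm : 1 ≤ m) (hd : 1 ≤ d) (hs : s ≤ d) (ht : t ≤ d) :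
    Set.BijOn rho {M : List DStep | IsGoodPath m d n s t M}
      {M : List DStep | IsGoodPath m d n t s M} ∧
    ∀ M : List DStep, rho (rho M) = M := by
  refine ⟨⟨fun M hM => isGoodPath_rho' hs ht hM, ?_, ?_⟩, rho_rho'⟩
  · intro A _ B _ h
    rw [← rho_rho' A, h, rho_rho']
  · intro M hM
    exact ⟨rho M, isGoodPath_rho' ht hs hM, rho_rho' M⟩
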